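/- arXiv:math/0504552 — 5 statements merged into one kernel-verified Lean document; each statement's English description precedes it below -/
import Mathlib

section
/- For all real numbers x, y with 0 < |x| < 1 and |y| < 1, one has \sum_{0<m<n} x^{m-1} y^n/n = (1/(1-x)) · ( -log(1-y) + log(1-xy)/x ), where the sum is over pairs of integers with 0 < m < n. -/
/-- Pairs `0 < m < n` are parametrised by `(i + 1, n + 1)` with `i < n`. -/
def sigmaFinEquivPosLt : (Σ n : ℕ, Fin n) ≃ {p : ℕ × ℕ // 0 < p.1 ∧ p.1 < p.2} where
  toFun s := ⟨(s.2.1 + 1, s.1 + 1), by simp⟩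
  invFun p := ⟨p.1.2 - 1, ⟨p.1.1 - 1, by have := p.2; omega⟩⟩
  left_inv s := rfl
  right_inv := by
    rintro ⟨⟨m, n⟩, h₁, h₂⟩
    simp only at h₁ h₂
    simp only [Subtype.mk.injEq, Prod.mk.injEq]
    omega

theorem hasSum_sum_fin_pow_mul_pow_div {x y : ℝ} (hx0 : x ≠ 0) (hx : |x| < 1) (hy : |y| < 1) :
    HasSum (fun n : ℕ => ∑ i : Fin n, x ^ (i : ℕ) * y ^ (n + 1) / ((n : ℝ) + 1))
      ((1 / (1 - x)) * (-Real.log (1 - y) + Real.log (1 - x * y) / x)) := by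
  have hx1 : x ≠ 1 := by rintro rfl; simp at hx
  have hx1' : 1 - x ≠ 0 := sub_ne_zero.mpr hx1.symm
  have hxy : |x * y| < 1 := by
    rw [abs_mul]
    exact mul_lt_one_of_nonneg_of_lt_one_left (abs_nonneg x) hx hy.le
  have h := ((Real.hasSum_pow_div_log_of_abs_lt_one hy).sub
    ((Real.hasSum_pow_div_log_of_abs_lt_one hxy).div_const x)).mul_left (1 / (1 - x))
  convert! h using 1
  · funext n
    have hn : (n : ℝ) + 1 ≠ 0 := by positivity
    have hgeom : ∑ i : Fin n, x ^ (i : ℕ) = (1 - x ^ n) / (1 - x) := by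
      rw [Fin.sum_univ_eq_sum_range (fun i => x ^ i), eq_div_iff hx1', geom_sum_mul_neg]
    rw [← Finset.sum_div, ← Finset.sum_mul, hgeom, mul_pow, pow_succ x]
    field_simp
  · ring

/-- For real `0 < |x| < 1`, `|y| < 1`:
`∑_{0<m<n} x^{m-1} y^n / n = (1/(1-x)) (-log(1-y) + log(1-xy)/x)`. -/
theorem double_log_deriv_series_x (x y : ℝ)
    (hx0 : 0 < |x|) (hx : |x| < 1) (hy : |y| < 1) :
    ∑' p : {p : ℕ × ℕ // 0 < p.1 ∧ p.1 < p.2},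
        x ^ (p.1.1 - 1) * y ^ p.1.2 / (p.1.2 : ℝ) =
      (1 / (1 - x)) * (-Real.log (1 - y) + Real.log (1 - x * y) / x) := by
  rw [← sigmaFinEquivPosLt.tsum_eq]
  simp only [sigmaFinEquivPosLt, Equiv.coe_fn_mk, Nat.add_sub_cancel, Nat.cast_add, Nat.cast_one]
  have hsum : Summable fun s : (Σ n : ℕ, Fin n) =>
      x ^ (s.2 : ℕ) * y ^ (s.1 + 1) / ((s.1 : ℝ) + 1) := by
    refine Summable.of_norm ((summable_sigma_of_nonneg fun _ => norm_nonneg _).2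
      ⟨fun n => (hasSum_fintype _).summable, ?_⟩)
    convert! (hasSum_sum_fin_pow_mul_pow_div hx0.ne' (by rwa [abs_abs])
      (by rwa [abs_abs] : |(|y|)| < 1)).summable using 2 with n
    rw [tsum_fintype]
    refine Finset.sum_congr rfl fun i _ => ?_
    have hn : |(n : ℝ) + 1| = n + 1 := abs_of_nonneg (by positivity)
    simp only [Real.norm_eq_abs, abs_div, abs_mul, abs_pow, hn]
  rw [hsum.tsum_sigma]
  simp only [tsum_fintype]
  exact (hasSum_sum_fin_pow_mul_pow_div (abs_pos.mp hx0) hx hy).tsum_eq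
end

section
/- For all real numbers x, y with |x| < 1 and |y| < 1, one has \sum_{0<m<n} (x^m/m) y^{n-1} = -log(1-xy)/(1-y), where the sum is over pairs of integers with 0 < m < n. -/
/-- Pairs of natural numbers `(a, k)` parametrize the pairs `0 < m < n` through
`m = a + 1`, `n = a + k + 2`. -/
def posLtPairEquiv : ℕ × ℕ ≃ {p : ℕ × ℕ // 0 < p.1 ∧ p.1 < p.2} where
  toFun q := ⟨(q.1 + 1, q.1 + q.2 + 2), by constructor <;> dsimp only <;> omega⟩
  invFun p := (p.1.1 - 1, p.1.2 - p.1.1 - 1)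
  left_inv := by
    rintro ⟨a, k⟩
    ext <;> dsimp only <;> omega
  right_inv := by
    rintro ⟨⟨m, n⟩, hm, hn⟩
    dsimp only at hm hn
    ext <;> dsimp only <;> omega

/-- For real `|x| < 1`, `|y| < 1`:
`∑_{0<m<n} (x^m/m) y^{n-1} = -log(1-xy)/(1-y)`. -/
theorem double_log_deriv_series_y (x y : ℝ) (hx : |x| < 1) (hy : |y| < 1) :
    ∑' p : {p : ℕ × ℕ // 0 < p.1 ∧ p.1 < p.2},
        (x ^ p.1.1 / (p.1.1 : ℝ)) * y ^ (p.1.2 - 1) =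
      -Real.log (1 - x * y) / (1 - y) := by
  have hxy : |x * y| < 1 := by
    rw [abs_mul]
    exact mul_lt_one_of_nonneg_of_lt_one_left (abs_nonneg x) hx hy.le
  have hlog := Real.hasSum_pow_div_log_of_abs_lt_one hxy
  have hgeom := hasSum_geometric_of_abs_lt_one hy
  have hprod := tsum_mul_tsum_of_summable_norm hlog.summable.norm hgeom.summable.norm
  rw [hlog.tsum_eq, hgeom.tsum_eq] at hprod
  rw [div_eq_mul_inv, hprod, ← posLtPairEquiv.tsum_eq]
  refine tsum_congr fun q => ?_
  have hexp : q.1 + q.2 + 2 - 1 = (q.1 + 1) + q.2 := by omega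
  simp only [posLtPairEquiv, Equiv.coe_fn_mk, hexp]
  push_cast
  ring
end

section
/- Fix a real number y with |y| < 1. The function x ↦ Li_{1,1}(x,y) = \sum_{0<m<n} (x^m/m)(y^n/n) has, at every real point x with 0 < |x| < 1, derivative equal to -log(1-y)/(1-x) + log(1-xy)/(x(1-x)). -/
/-- Pairs `0 < m < n` are parametrized by `n = N + 1` and `m = k + 1` with `k < N`. -/
def posPairEquivSigmaFin : (Σ N : ℕ, Fin N) ≃ {p : ℕ × ℕ // 0 < p.1 ∧ p.1 < p.2} where
  toFun q := ⟨(q.2 + 1, q.1 + 1), by simp, by simp⟩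
  invFun p := ⟨p.1.2 - 1, ⟨p.1.1 - 1, by have := p.2; omega⟩⟩
  left_inv q := by simp
  right_inv p := by
    obtain ⟨⟨m, n⟩, h1, h2⟩ := p
    dsimp only at h1 h2
    simp only [Subtype.mk.injEq, Prod.mk.injEq]
    omega

theorem summable_pow_mul_pow_posPair {r s : ℝ} (hr0 : 0 ≤ r) (hr : r < 1) (hs0 : 0 ≤ s)
    (hs : s < 1) :
    Summable fun p : {p : ℕ × ℕ // 0 < p.1 ∧ p.1 < p.2} => r ^ (p.1.1 - 1) * s ^ p.1.2 := by
  have h1 : Summable fun m : ℕ => r ^ (m - 1) := by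
    rw [← summable_nat_add_iff 1]
    simpa using summable_geometric_of_lt_one hr0 hr
  have h2 := h1.mul_of_nonneg (summable_geometric_of_lt_one hs0 hs)
    (fun m => by positivity) (fun n => by positivity)
  exact h2.subtype {p : ℕ × ℕ | 0 < p.1 ∧ p.1 < p.2}

theorem norm_pow_mul_pow_div_le {t r y : ℝ} (htr : |t| ≤ r) (k n : ℕ) :
    ‖t ^ k * (y ^ n / n)‖ ≤ r ^ k * |y| ^ n := by
  have hr : 0 ≤ r := (abs_nonneg t).trans htr
  rw [norm_mul, norm_div, norm_pow, norm_pow, Real.norm_natCast, Real.norm_eq_abs,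
    Real.norm_eq_abs]
  have hn : |y| ^ n / n ≤ |y| ^ n := by
    rcases n.eq_zero_or_pos with rfl | hn
    · simp
    · exact div_le_self (by positivity) (by exact_mod_cast hn)
  gcongr

theorem tsum_pow_pred_mul_pow_div {x y : ℝ} (hx0 : x ≠ 0) (hx : |x| < 1) (hy : |y| < 1) :
    ∑' p : {p : ℕ × ℕ // 0 < p.1 ∧ p.1 < p.2}, x ^ (p.1.1 - 1) * (y ^ p.1.2 / (p.1.2 : ℝ)) =
      -Real.log (1 - y) / (1 - x) + Real.log (1 - x * y) / (x * (1 - x)) := by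
  have hx1 : 1 - x ≠ 0 := by linarith [(abs_lt.1 hx).2]
  have hsum : Summable fun p : {p : ℕ × ℕ // 0 < p.1 ∧ p.1 < p.2} =>
      x ^ (p.1.1 - 1) * (y ^ p.1.2 / (p.1.2 : ℝ)) :=
    .of_norm_bounded (summable_pow_mul_pow_posPair (abs_nonneg x) hx (abs_nonneg y) hy)
      fun p => norm_pow_mul_pow_div_le le_rfl _ _
  have hxy : |x * y| < 1 := by
    rw [abs_mul]
    exact mul_lt_one_of_nonneg_of_lt_one_left (abs_nonneg x) hx hy.le
  have hinner : ∀ N : ℕ, HasSum (fun k : Fin N => x ^ (k : ℕ) * (y ^ (N + 1) / ((N + 1 : ℕ) : ℝ)))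
      ((1 - x)⁻¹ * (y ^ (N + 1) / ((N : ℝ) + 1))
        - (x * (1 - x))⁻¹ * ((x * y) ^ (N + 1) / ((N : ℝ) + 1))) := by
    intro N
    convert! hasSum_fintype _ using 1
    rw [← Finset.sum_mul, Fin.sum_univ_eq_sum_range (fun k => x ^ k), geom_sum_eq (by grind)]
    have : x - 1 ≠ 0 := by grind
    have : (N : ℝ) + 1 ≠ 0 := by positivity
    push_cast
    rw [← neg_sub 1 x]
    field_simp
    ring
  have houter := ((Real.hasSum_pow_div_log_of_abs_lt_one hy).mul_left (1 - x)⁻¹).sub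
    ((Real.hasSum_pow_div_log_of_abs_lt_one hxy).mul_left (x * (1 - x))⁻¹)
  have hs := posPairEquivSigmaFin.hasSum_iff.2 hsum.hasSum
  have := (hs.sigma (by simpa [posPairEquivSigmaFin] using hinner)).unique houter
  rw [this]
  field_simp
  ring


/-- For fixed real `|y| < 1`, the function `x ↦ Li_{1,1}(x,y)` has at each
`0 < |x| < 1` derivative `-log(1-y)/(1-x) + log(1-xy)/(x(1-x))`. -/
theorem double_log_hasDerivAt_x (y : ℝ) (hy : |y| < 1)
    (x : ℝ) (hx0 : 0 < |x|) (hx : |x| < 1) :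
    HasDerivAt (fun t : ℝ =>
        ∑' p : {p : ℕ × ℕ // 0 < p.1 ∧ p.1 < p.2},
          (t ^ p.1.1 / (p.1.1 : ℝ)) * (y ^ p.1.2 / (p.1.2 : ℝ)))
      (-Real.log (1 - y) / (1 - x) + Real.log (1 - x * y) / (x * (1 - x))) x := by
  obtain ⟨r, hxr, hr⟩ := exists_between hx
  have hr0 : 0 < r := hx0.trans hxr
  have hmem : ∀ t ∈ Metric.ball (0 : ℝ) r, |t| ≤ r := fun t ht => by
    simpa using (mem_ball_zero_iff.1 ht).le
  rw [← tsum_pow_pred_mul_pow_div (abs_pos.1 hx0) hx hy]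
  refine hasDerivAt_tsum_of_isPreconnected
    (summable_pow_mul_pow_posPair hr0.le hr (abs_nonneg y) hy) Metric.isOpen_ball
    (convex_ball (0 : ℝ) r).isPreconnected (fun p t _ => ?_)
    (fun p t ht => norm_pow_mul_pow_div_le (hmem t ht) _ _)
    (Metric.mem_ball_self hr0) ?_ (by simpa using hxr)
  · have hp : (p.1.1 : ℝ) ≠ 0 := by exact_mod_cast p.2.1.ne'
    convert! ((hasDerivAt_pow p.1.1 t).div_const (p.1.1 : ℝ)).mul_const
      (y ^ p.1.2 / (p.1.2 : ℝ)) using 2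
    field_simp
  · convert summable_zero with p
    simp [p.2.1.ne']
end

section
/- Fix a real number x with |x| < 1. The function y ↦ Li_{1,1}(x,y) = \sum_{0<m<n} (x^m/m)(y^n/n) has, at every real point y with |y| < 1, derivative equal to -log(1-xy)/(1-y). -/
/-- Pairs `0 < m < n` are parametrized by `(j, k) ↦ (j + 1, j + k + 2)`. -/
def natPairEquivPosLt : ℕ × ℕ ≃ {p : ℕ × ℕ // 0 < p.1 ∧ p.1 < p.2} where
  toFun q := ⟨(q.1 + 1, q.1 + q.2 + 2), by constructor <;> dsimp only <;> omega⟩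
  invFun p := (p.1.1 - 1, p.1.2 - p.1.1 - 1)
  left_inv q := by ext <;> dsimp only <;> omega
  right_inv p := by
    obtain ⟨⟨m, n⟩, h1, h2⟩ := p
    dsimp only at h1 h2
    ext <;> dsimp only <;> omega

/-- Fubini for the termwise `y`-derivative of the double logarithm. -/
theorem hasSum_double_log_deriv {x y : ℝ} (hxy : |x * y| < 1) (hy : |y| < 1) :
    HasSum (fun q : ℕ × ℕ => x ^ (q.1 + 1) / ((q.1 + 1 : ℕ) : ℝ) * y ^ (q.1 + q.2 + 1))
      (-Real.log (1 - x * y) / (1 - y)) := by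
  have h1 := Real.hasSum_pow_div_log_of_abs_lt_one hxy
  have h2 := hasSum_geometric_of_abs_lt_one hy
  have h3 := h1.mul h2 (summable_mul_of_summable_norm h1.summable.norm h2.summable.norm)
  rw [← div_eq_mul_inv] at h3
  refine h3.congr_fun fun q => ?_
  push_cast
  ring

/-- For fixed real `|x| < 1`, the function `y ↦ Li_{1,1}(x,y)` has at each
`|y| < 1` derivative `-log(1-xy)/(1-y)`. -/
theorem double_log_hasDerivAt_y (x : ℝ) (hx : |x| < 1)
    (y : ℝ) (hy : |y| < 1) :
    HasDerivAt (fun t : ℝ =>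
        ∑' p : {p : ℕ × ℕ // 0 < p.1 ∧ p.1 < p.2},
          (x ^ p.1.1 / (p.1.1 : ℝ)) * (t ^ p.1.2 / (p.1.2 : ℝ)))
      (-Real.log (1 - x * y) / (1 - y)) y := by
  obtain ⟨r, hyr, hr1⟩ := exists_between hy
  have hr0 : 0 < r := (abs_nonneg y).trans_lt hyr
  have hxy : |x * y| < 1 := by
    rw [abs_mul]
    exact mul_lt_one_of_nonneg_of_lt_one_left (abs_nonneg x) hx hy.le
  simp_rw [← natPairEquivPosLt.tsum_eq (fun p : {p : ℕ × ℕ // 0 < p.1 ∧ p.1 < p.2} =>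
    (x ^ p.1.1 / (p.1.1 : ℝ)) * (_ ^ p.1.2 / (p.1.2 : ℝ)))]
  rw [← (hasSum_double_log_deriv hxy hy).tsum_eq]
  have hgeom : Summable fun n : ℕ => r ^ n := summable_geometric_of_lt_one hr0.le hr1
  refine hasDerivAt_tsum_of_isPreconnected (t := Set.Ioo (-r) r) (y₀ := 0)
    (u := fun q : ℕ × ℕ => r ^ q.1 * r ^ q.2)
    (g' := fun q t => x ^ (q.1 + 1) / ((q.1 + 1 : ℕ) : ℝ) * t ^ (q.1 + q.2 + 1))
    (summable_mul_of_summable_norm hgeom.norm hgeom.norm)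
    isOpen_Ioo isPreconnected_Ioo ?_ ?_ ⟨by linarith, hr0⟩ ?_ (abs_lt.mp hyr)
  · intro q t _
    refine HasDerivAt.const_mul _ ?_
    have h := (hasDerivAt_pow (q.1 + q.2 + 2) t).div_const ((q.1 + q.2 + 2 : ℕ) : ℝ)
    rwa [mul_div_cancel_left₀ _ (Nat.cast_ne_zero.mpr (by omega))] at h
  · intro q t ht
    have htr : |t| ≤ r := (abs_lt.mpr ht).le
    rw [norm_mul, norm_div, norm_pow, norm_pow, RCLike.norm_natCast,
      Real.norm_eq_abs, Real.norm_eq_abs]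
    have hcoef : |x| ^ (q.1 + 1) / ((q.1 + 1 : ℕ) : ℝ) ≤ 1 := by
      refine div_le_one_of_le₀ ?_ (Nat.cast_nonneg _)
      exact (pow_le_one₀ (abs_nonneg x) hx.le).trans (by exact_mod_cast Nat.succ_pos q.1)
    have hpow : |t| ^ (q.1 + q.2 + 1) ≤ r ^ q.1 * r ^ q.2 := by
      rw [← pow_add]
      exact (pow_le_pow_left₀ (abs_nonneg t) htr _).trans
        (pow_le_pow_of_le_one hr0.le hr1.le (Nat.le_succ _))
    exact (mul_le_of_le_one_left (by positivity) hcoef).trans hpow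
  · simp [natPairEquivPosLt, summable_zero]
end

section
/- For all real numbers z_1, z_2, z_3 with 0 < z_i < 1 for i = 1,2,3, setting x_1 = 1/(z_1 z_2 z_3), x_2 = 1/(z_2 z_3), x_3 = 1/z_3, one has Li_{1,1,1}(z_1,z_2,z_3) = - \int_{\Delta_3} 1/((t_1 - x_1)(t_2 - x_2)(t_3 - x_3)) dt_1 dt_2 dt_3, where \Delta_3 = {(t_1,t_2,t_3) ∈ [0,1]^3 : t_1 ≤ t_2 ≤ t_3} carries Lebesgue measure. -/
open MeasureTheory

/-- Tonelli on the ordered 3-simplex, for products of functions of one variable. -/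
theorem lintegral_orderedSimplex_mul {f g h : ℝ → ENNReal} (hf : Measurable f)
    (hg : Measurable g) (hh : Measurable h) :
    ∫⁻ t in {t : Fin 3 → ℝ | (∀ i, t i ∈ Set.Icc (0:ℝ) 1) ∧ t 0 ≤ t 1 ∧ t 1 ≤ t 2},
        f (t 0) * g (t 1) * h (t 2) =
      ∫⁻ z in Set.Icc (0:ℝ) 1, h z * ∫⁻ y in Set.Icc 0 z, g y * ∫⁻ x in Set.Icc 0 y, f x := by
  let S : Set (ℝ × ℝ × ℝ) :=
    {p | 0 ≤ p.2.1 ∧ p.2.1 ≤ p.2.2 ∧ p.2.2 ≤ p.1 ∧ p.1 ≤ 1}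
  have hS : MeasurableSet S := by
    refine IsClosed.measurableSet ?_
    simp only [S, Set.ofPred_and]
    exact (isClosed_le (by fun_prop) (by fun_prop)).inter
      ((isClosed_le (by fun_prop) (by fun_prop)).inter
        ((isClosed_le (by fun_prop) (by fun_prop)).inter
          (isClosed_le (by fun_prop) (by fun_prop))))
  let G : ℝ × ℝ × ℝ → ENNReal := S.indicator fun p => f p.2.1 * g p.2.2 * h p.1
  have hG : Measurable G := Measurable.indicator (by fun_prop) hS
  have he : MeasurePreserving (fun t : Fin 3 → ℝ => (t 2, t 0, t 1)) :=
    ((MeasurePreserving.id volume).prod (volume_preserving_finTwoArrow ℝ)).comp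
      (volume_preserving_piFinSuccAbove (fun _ : Fin 3 => ℝ) 2)
  have hset : {t : Fin 3 → ℝ | (∀ i, t i ∈ Set.Icc (0:ℝ) 1) ∧ t 0 ≤ t 1 ∧ t 1 ≤ t 2} =
      (fun t : Fin 3 → ℝ => (t 2, t 0, t 1)) ⁻¹' S := by
    ext t
    simp only [S, Fin.forall_fin_succ, Set.mem_ofPred_eq, Set.mem_preimage, Set.mem_Icc]
    constructor
    · rintro ⟨⟨h0, h1, h2, -⟩, h3, h4⟩
      exact ⟨h0.1, h3, h4, h2.2⟩
    · rintro ⟨h0, h1, h2, h3⟩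
      refine ⟨⟨⟨h0, ?_⟩, ⟨?_, ?_⟩, ⟨?_, h3⟩, fun i => i.elim0⟩, h1, h2⟩
      · linarith
      · exact h0.trans h1
      · exact h2.trans h3
      · exact (h0.trans h1).trans h2
  rw [hset, ← lintegral_indicator (he.measurable hS)]
  have hcomp := he.lintegral_comp hG
  have hleft : ((fun t : Fin 3 → ℝ => (t 2, t 0, t 1)) ⁻¹' S).indicator
      (fun t => f (t 0) * g (t 1) * h (t 2)) = fun t => G (t 2, t 0, t 1) := rfl
  rw [hleft, hcomp, Measure.volume_eq_prod, lintegral_prod _ hG.aemeasurable,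
    ← lintegral_indicator measurableSet_Icc]
  refine lintegral_congr fun z => ?_
  have hGz : Measurable fun q : ℝ × ℝ => G (z, q) := hG.comp measurable_prodMk_left
  rw [Measure.volume_eq_prod, lintegral_prod_symm _ hGz.aemeasurable]
  have hF : Measurable fun y : ℝ => ∫⁻ x in Set.Icc 0 y, f x :=
    Monotone.measurable fun _ _ hab => lintegral_mono_set (Set.Icc_subset_Icc_right hab)
  by_cases hz : z ∈ Set.Icc (0:ℝ) 1
  · rw [Set.indicator_of_mem hz, ← lintegral_const_mul _ (by fun_prop),
      ← lintegral_indicator measurableSet_Icc]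
    refine lintegral_congr fun y => ?_
    by_cases hy : y ∈ Set.Icc 0 z
    · rw [Set.indicator_of_mem hy, ← mul_assoc, ← lintegral_const_mul _ hf,
        ← lintegral_indicator measurableSet_Icc]
      refine lintegral_congr fun x => ?_
      by_cases hx : x ∈ Set.Icc 0 y
      · have hmem : (z, x, y) ∈ S := ⟨hx.1, hx.2, hy.2, hz.2⟩
        rw [Set.indicator_of_mem hx]
        simp only [G, Set.indicator_of_mem hmem]
        ring
      · have hmem : (z, x, y) ∉ S := fun hp => hx ⟨hp.1, hp.2.1⟩
        rw [Set.indicator_of_notMem hx]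
        exact Set.indicator_of_notMem hmem _
    · rw [Set.indicator_of_notMem hy]
      refine (lintegral_congr fun x => ?_).trans lintegral_zero
      exact Set.indicator_of_notMem (fun hp => hy ⟨hp.1.trans hp.2.1, hp.2.2.1⟩) _
  · rw [Set.indicator_of_notMem hz]
    refine (lintegral_congr fun y =>
      (lintegral_congr fun x => ?_).trans lintegral_zero).trans lintegral_zero
    exact Set.indicator_of_notMem
      (fun hp => hz ⟨(hp.1.trans hp.2.1).trans hp.2.2.1, hp.2.2.2⟩) _

theorem lintegral_Icc_ofReal_pow (n : ℕ) {s : ℝ} (hs : 0 ≤ s) :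
    ∫⁻ x in Set.Icc 0 s, ENNReal.ofReal (x ^ n) = ENNReal.ofReal (s ^ (n + 1) / (n + 1)) := by
  rw [← ofReal_integral_eq_lintegral_ofReal, integral_Icc_eq_integral_Ioc,
    ← intervalIntegral.integral_of_le hs, integral_pow]
  · simp
  · exact (continuous_pow n).integrableOn_Icc
  · filter_upwards [ae_restrict_mem measurableSet_Icc] with x hx
    exact pow_nonneg hx.1 n

theorem lintegral_orderedSimplex_monomial (a b c : ℕ) :
    ∫⁻ t in {t : Fin 3 → ℝ | (∀ i, t i ∈ Set.Icc (0:ℝ) 1) ∧ t 0 ≤ t 1 ∧ t 1 ≤ t 2},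
        ENNReal.ofReal (t 0 ^ a) * ENNReal.ofReal (t 1 ^ b) * ENNReal.ofReal (t 2 ^ c) =
      ENNReal.ofReal (1 / ((a + 1) * (a + b + 2) * (a + b + c + 3))) := by
  have hinner (y : ℝ) (hy : 0 ≤ y) :
      ENNReal.ofReal (y ^ b) * ∫⁻ x in Set.Icc 0 y, ENNReal.ofReal (x ^ a) =
        ENNReal.ofReal (1 / (a + 1)) * ENNReal.ofReal (y ^ (a + b + 1)) := by
    rw [lintegral_Icc_ofReal_pow a hy, ← ENNReal.ofReal_mul (by positivity),
      ← ENNReal.ofReal_mul (by positivity)]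
    congr 1
    ring
  have hmiddle (z : ℝ) (hz : 0 ≤ z) :
      ENNReal.ofReal (z ^ c) * ∫⁻ y in Set.Icc 0 z,
          ENNReal.ofReal (y ^ b) * ∫⁻ x in Set.Icc 0 y, ENNReal.ofReal (x ^ a) =
        ENNReal.ofReal (1 / ((a + 1) * (a + b + 2))) *
          ENNReal.ofReal (z ^ (a + b + c + 2)) := by
    rw [setLIntegral_congr_fun measurableSet_Icc fun y hy => hinner y hy.1,
      lintegral_const_mul' _ _ ENNReal.ofReal_ne_top, lintegral_Icc_ofReal_pow _ hz,
      ← ENNReal.ofReal_mul (by positivity), ← ENNReal.ofReal_mul (by positivity),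
      ← ENNReal.ofReal_mul (by positivity)]
    congr 1
    push_cast
    field_simp
    ring
  rw [lintegral_orderedSimplex_mul (f := fun x => ENNReal.ofReal (x ^ a))
      (g := fun x => ENNReal.ofReal (x ^ b)) (h := fun x => ENNReal.ofReal (x ^ c))
      (by fun_prop) (by fun_prop) (by fun_prop),
    setLIntegral_congr_fun measurableSet_Icc fun z hz => hmiddle z hz.1,
    lintegral_const_mul' _ _ ENNReal.ofReal_ne_top, lintegral_Icc_ofReal_pow _ zero_le_one,
    ← ENNReal.ofReal_mul (by positivity)]
  congr 1
  push_cast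
  rw [one_pow]
  field_simp
  ring

theorem ofReal_one_div_inv_sub {w t : ℝ} (hw : 0 < w) (ht : 0 ≤ t) (h : w * t < 1) :
    ENNReal.ofReal (1 / (1 / w - t)) =
      ∑' n : ℕ, ENNReal.ofReal (w ^ (n + 1)) * ENNReal.ofReal (t ^ n) := by
  have hs := (hasSum_geometric_of_lt_one (mul_nonneg hw.le ht) h).mul_left w
  have heq : 1 / (1 / w - t) = ∑' n : ℕ, w * (w * t) ^ n := by
    rw [hs.tsum_eq]
    have : 1 - w * t ≠ 0 := by linarith
    have : 1 / w - t = (1 - w * t) / w := by field_simp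
    rw [this]
    field_simp
  rw [heq, ENNReal.ofReal_tsum_of_nonneg (fun n => by positivity) hs.summable]
  refine tsum_congr fun n => ?_
  rw [← ENNReal.ofReal_mul (by positivity)]
  congr 1
  ring

/-- Strictly increasing triples of positive integers, parametrised by their gaps. -/
def gapEquiv :
    ℕ × ℕ × ℕ ≃ {k : ℕ × ℕ × ℕ // 0 < k.1 ∧ k.1 < k.2.1 ∧ k.2.1 < k.2.2} where
  toFun p := ⟨(p.1 + 1, p.1 + p.2.1 + 2, p.1 + p.2.1 + p.2.2 + 3), by
    refine ⟨?_, ?_, ?_⟩ <;> dsimp only <;> omega⟩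
  invFun k := (k.1.1 - 1, k.1.2.1 - k.1.1 - 1, k.1.2.2 - k.1.2.1 - 1)
  left_inv := by
    rintro ⟨a, b, c⟩
    simp only [Prod.mk.injEq]
    omega
  right_inv := by
    rintro ⟨⟨a, b, c⟩, h⟩
    simp only [Subtype.mk.injEq, Prod.mk.injEq]
    dsimp only at h
    omega

theorem ENNReal.tsum_mul_tsum_mul_tsum (u v w : ℕ → ENNReal) :
    (∑' n, u n) * (∑' n, v n) * (∑' n, w n) =
      ∑' p : ℕ × ℕ × ℕ, u p.1 * v p.2.1 * w p.2.2 := by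
  rw [ENNReal.tsum_prod', mul_assoc, ← ENNReal.tsum_mul_right]
  refine tsum_congr fun a => ?_
  rw [ENNReal.tsum_prod', ← ENNReal.tsum_mul_right, ← ENNReal.tsum_mul_left]
  refine tsum_congr fun b => ?_
  rw [← ENNReal.tsum_mul_left, ← ENNReal.tsum_mul_left]
  exact tsum_congr fun c => (mul_assoc _ _ _).symm

/-- For real `0 < zᵢ < 1` (`i = 1,2,3`), with `x₁ = 1/(z₁z₂z₃)`, `x₂ = 1/(z₂z₃)`,
`x₃ = 1/z₃`: `Li_{1,1,1}(z₁,z₂,z₃) = -∫_{Δ₃} ∏ᵢ dtᵢ/(tᵢ-xᵢ)` where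
`Δ₃ = {(t₁,t₂,t₃) ∈ [0,1]³ : t₁ ≤ t₂ ≤ t₃}`. -/
theorem triple_log_eq_simplex_integral (z₁ z₂ z₃ : ℝ)
    (h₁ : 0 < z₁) (h₁' : z₁ < 1) (h₂ : 0 < z₂) (h₂' : z₂ < 1)
    (h₃ : 0 < z₃) (h₃' : z₃ < 1) :
    ∑' k : {k : ℕ × ℕ × ℕ // 0 < k.1 ∧ k.1 < k.2.1 ∧ k.2.1 < k.2.2},
        (z₁ ^ k.1.1 / (k.1.1 : ℝ)) * (z₂ ^ k.1.2.1 / (k.1.2.1 : ℝ)) *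
          (z₃ ^ k.1.2.2 / (k.1.2.2 : ℝ)) =
      -∫ t in {t : Fin 3 → ℝ | (∀ i, t i ∈ Set.Icc (0:ℝ) 1) ∧ t 0 ≤ t 1 ∧ t 1 ≤ t 2},
        1 / ((t 0 - 1 / (z₁ * z₂ * z₃)) * (t 1 - 1 / (z₂ * z₃)) * (t 2 - 1 / z₃)) := by
  set Δ := {t : Fin 3 → ℝ | (∀ i, t i ∈ Set.Icc (0:ℝ) 1) ∧ t 0 ≤ t 1 ∧ t 1 ≤ t 2} with hΔ
  have hΔm : MeasurableSet Δ := by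
    refine IsClosed.measurableSet ?_
    simp only [hΔ, Set.ofPred_and, Set.ofPred_forall]
    exact (isClosed_iInter fun i => isClosed_Icc.preimage (continuous_apply i)).inter
      ((isClosed_le (by fun_prop) (by fun_prop)).inter (isClosed_le (by fun_prop) (by fun_prop)))
  have h23 : z₂ * z₃ < 1 := mul_lt_one_of_nonneg_of_lt_one_left h₂.le h₂' h₃'.le
  have h123 : z₁ * z₂ * z₃ < 1 := by
    rw [mul_assoc]
    exact mul_lt_one_of_nonneg_of_lt_one_left h₁.le h₁' h23.le
  have hpos {w t : ℝ} (hw : 0 < w) (hw1 : w < 1) (ht : t ∈ Set.Icc (0:ℝ) 1) :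
      0 < 1 / w - t := by
    have := one_lt_one_div hw hw1
    linarith [ht.2]
  have hlt {w t : ℝ} (hw : 0 < w) (hw1 : w < 1) (ht : t ∈ Set.Icc (0:ℝ) 1) : w * t < 1 :=
    (mul_le_of_le_one_right hw.le ht.2).trans_lt hw1
  have hneg (t : Fin 3 → ℝ) :
      -(1 / ((t 0 - 1 / (z₁ * z₂ * z₃)) * (t 1 - 1 / (z₂ * z₃)) * (t 2 - 1 / z₃))) =
        1 / (1 / (z₁ * z₂ * z₃) - t 0) * (1 / (1 / (z₂ * z₃) - t 1)) *
          (1 / (1 / z₃ - t 2)) := by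
    rw [one_div_mul_one_div, one_div_mul_one_div, ← one_div_neg_eq_neg_one_div]
    congr 1
    ring
  have hexpand (t : Fin 3 → ℝ) (ht : t ∈ Δ) :
      ENNReal.ofReal (1 / (1 / (z₁ * z₂ * z₃) - t 0) * (1 / (1 / (z₂ * z₃) - t 1)) *
          (1 / (1 / z₃ - t 2))) =
        ∑' p : ℕ × ℕ × ℕ, ENNReal.ofReal
            ((z₁ * z₂ * z₃) ^ (p.1 + 1) * (z₂ * z₃) ^ (p.2.1 + 1) * z₃ ^ (p.2.2 + 1)) *
          (ENNReal.ofReal (t 0 ^ p.1) * ENNReal.ofReal (t 1 ^ p.2.1) *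
            ENNReal.ofReal (t 2 ^ p.2.2)) := by
    have p0 := hpos (by positivity) h123 (ht.1 0)
    have p1 := hpos (by positivity) h23 (ht.1 1)
    rw [ENNReal.ofReal_mul (by positivity), ENNReal.ofReal_mul (by positivity),
      ofReal_one_div_inv_sub (by positivity) (ht.1 0).1 (hlt (by positivity) h123 (ht.1 0)),
      ofReal_one_div_inv_sub (by positivity) (ht.1 1).1 (hlt (by positivity) h23 (ht.1 1)),
      ofReal_one_div_inv_sub h₃ (ht.1 2).1 (hlt h₃ h₃' (ht.1 2)),
      ENNReal.tsum_mul_tsum_mul_tsum]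
    refine tsum_congr fun p => ?_
    rw [ENNReal.ofReal_mul (by positivity), ENNReal.ofReal_mul (by positivity)]
    ring
  rw [← integral_neg]
  simp_rw [hneg]
  rw [integral_eq_lintegral_of_nonneg_ae, setLIntegral_congr_fun hΔm hexpand, lintegral_tsum,
    ENNReal.tsum_toReal_eq, ← gapEquiv.tsum_eq]
  · refine tsum_congr fun p => ?_
    rw [lintegral_const_mul' _ _ ENNReal.ofReal_ne_top, lintegral_orderedSimplex_monomial,
      ← ENNReal.ofReal_mul (by positivity), ENNReal.toReal_ofReal (by positivity)]
    simp only [gapEquiv, Equiv.coe_fn_mk]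
    push_cast
    field_simp
    ring
  · intro p
    rw [lintegral_const_mul' _ _ ENNReal.ofReal_ne_top, lintegral_orderedSimplex_monomial]
    exact ENNReal.mul_ne_top ENNReal.ofReal_ne_top ENNReal.ofReal_ne_top
  · intro p
    fun_prop
  · filter_upwards [ae_restrict_mem hΔm] with t ht
    have p0 := hpos (by positivity) h123 (ht.1 0)
    have p1 := hpos (by positivity) h23 (ht.1 1)
    have p2 := hpos h₃ h₃' (ht.1 2)
    simp only [Pi.zero_apply]
    positivity
  · exact Measurable.aestronglyMeasurable (by fun_prop)
end
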